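/- The spider tree Y_2, consisting of a center vertex with three pendant paths of length 2 attached to it, admits no (2,3,3,3)-packing coloring. -/

import Mathlib

/-- `c` is an `s`-packing coloring of the simple graph `G`: for each color `i`, any two
distinct vertices with color `i` are at graph distance strictly greater than `s i`
(vertices in different connected components trivially satisfy this). -/
def IsPackingColoring {V : Type*} (G : SimpleGraph V) {k : ℕ} (s : Fin k → ℕ)
    (c : V → Fin k) : Prop :=
  ∀ u v : V, u ≠ v → c u = c v → G.Reachable u v → s (c u) < G.dist u v

/-- The spider tree `Y₂`: a center (vertex `0`) with three pendant paths of length `2`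
(legs `1-2`, `3-4`, `5-6`). -/
def spiderY2 : SimpleGraph (Fin 7) :=
  SimpleGraph.fromRel (fun u v =>
    (u, v) ∈ ([(0,1),(1,2),(0,3),(3,4),(0,5),(5,6)] : List (Fin 7 × Fin 7)))

/-- Vertices of the same color in a packing coloring are not joined by a short walk. -/
theorem IsPackingColoring.lt_length {V : Type*} {G : SimpleGraph V} {k : ℕ} {s : Fin k → ℕ}
    {c : V → Fin k} (hc : IsPackingColoring G s c) {u v : V} (huv : u ≠ v) (h : c u = c v)
    (p : G.Walk u v) : s (c u) < p.length :=
  (hc u v huv h p.reachable).trans_le (SimpleGraph.dist_le p)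

/-- Four distinct elements exhaust `Fin 4`. -/
theorem Fin.eq_or_eq_or_eq_or_eq_of_ne {a b c d : Fin 4} (hab : a ≠ b) (hac : a ≠ c)
    (had : a ≠ d) (hbc : b ≠ c) (hbd : b ≠ d) (hcd : c ≠ d) (x : Fin 4) :
    x = a ∨ x = b ∨ x = c ∨ x = d := by
  omega

instance : DecidableRel spiderY2.Adj := fun u v => by
  unfold spiderY2
  rw [SimpleGraph.fromRel_adj]
  infer_instance

/-- `Y₂` admits no `(2,3,3,3)`-packing coloring. -/
theorem spiderY2_not_2333_colorable :
    ¬ ∃ c : Fin 7 → Fin 4, IsPackingColoring spiderY2 ![2, 3, 3, 3] c := by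
  rintro ⟨c, hc⟩
  have two_le (i : Fin 4) : 2 ≤ (![2, 3, 3, 3] : Fin 4 → ℕ) i := by
    fin_cases i <;> simp
  have eq_zero (i : Fin 4) : (![2, 3, 3, 3] : Fin 4 → ℕ) i < 3 → i = 0 := by
    fin_cases i <;> simp
  have ne_of_adj {u v : Fin 7} (h : spiderY2.Adj u v) : c u ≠ c v := fun e => by
    have := hc.lt_length h.ne e (.cons h .nil)
    have := two_le (c u)
    simp at *
    omega
  have ne_of_adj_adj {u v w : Fin 7} (h : spiderY2.Adj u v) (h' : spiderY2.Adj v w)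
      (huw : u ≠ w) : c u ≠ c w := fun e => by
    have := hc.lt_length huw e (.cons h (.cons h' .nil))
    have := two_le (c u)
    simp at *
    omega
  have eq_zero_of_adj {u v w x : Fin 7} (h : spiderY2.Adj u v) (h' : spiderY2.Adj v w)
      (h'' : spiderY2.Adj w x) (hux : u ≠ x) (e : c u = c x) : c u = 0 :=
    eq_zero _ (hc.lt_length hux e (.cons h (.cons h' (.cons h'' .nil))))
  have a01 : spiderY2.Adj 0 1 := by decide
  have a12 : spiderY2.Adj 1 2 := by decide
  have a03 : spiderY2.Adj 0 3 := by decide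
  have a34 : spiderY2.Adj 3 4 := by decide
  have a05 : spiderY2.Adj 0 5 := by decide
  have a56 : spiderY2.Adj 5 6 := by decide
  -- the center and its neighbors use all four colors
  have n01 := ne_of_adj a01
  have n03 := ne_of_adj a03
  have n05 := ne_of_adj a05
  have n13 := ne_of_adj_adj a01.symm a03 (by decide)
  have n15 := ne_of_adj_adj a01.symm a05 (by decide)
  have n35 := ne_of_adj_adj a03.symm a05 (by decide)
  have cover (x : Fin 4) : x = c 0 ∨ x = c 1 ∨ x = c 3 ∨ x = c 5 :=
    Fin.eq_or_eq_or_eq_or_eq_of_ne n01 n03 n05 n13 n15 n35 x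
  have cover_zero := cover 0
  have cover_two := cover (c 2)
  have cover_four := cover (c 4)
  have cover_six := cover (c 6)
  -- so every leaf has color `0`, which is then unavailable for the center and its neighbors
  have n12 := ne_of_adj a12
  have n34 := ne_of_adj a34
  have n56 := ne_of_adj a56
  have n02 := ne_of_adj_adj a01 a12 (by decide)
  have n04 := ne_of_adj_adj a03 a34 (by decide)
  have n06 := ne_of_adj_adj a05 a56 (by decide)
  have z14 := eq_zero_of_adj a01.symm a03 a34 (by decide)
  have z16 := eq_zero_of_adj a01.symm a05 a56 (by decide)
  have z32 := eq_zero_of_adj a03.symm a01 a12 (by decide)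
  have z36 := eq_zero_of_adj a03.symm a05 a56 (by decide)
  have z52 := eq_zero_of_adj a05.symm a01 a12 (by decide)
  have z54 := eq_zero_of_adj a05.symm a03 a34 (by decide)
  have z2 : c 2 = 0 := by grind
  have z4 : c 4 = 0 := by grind
  have z6 : c 6 = 0 := by grind
  grind
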